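/- Let k ≠ 0 be a real number and let (bₙ)ₙ≥₁ be a bounded sequence of real numbers. Then for every x ∈ ℝ and every t > 0 the series u(x,t) := ∑ₙ₌₁^∞ bₙ · e^{−k²n²t} · sin(n·x) converges; the resulting function u is twice continuously differentiable on ℝ × (0, ∞), satisfies the heat equation ∂u/∂t = k² ∂²u/∂x² at every point of ℝ × (0, ∞), and satisfies u(0,t) = u(π,t) = 0 for all t > 0. -/

import Mathlib

open Real

/-- The `n`-th term of the phase-shifted heat series with coefficients `c`. -/
noncomputable def heatTerm (k : ℝ) (c : ℕ → ℝ) (θ : ℝ) (n : ℕ) (p : ℝ × ℝ) : ℝ :=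
  c n * Real.exp (-(k ^ 2) * n ^ 2 * p.2) * Real.sin (n * p.1 + θ)

/-- The phase-shifted heat series with coefficients `c`. -/
noncomputable def heatSeries (k : ℝ) (c : ℕ → ℝ) (θ : ℝ) (p : ℝ × ℝ) : ℝ :=
  ∑' n : ℕ, heatTerm k c θ n p

/-- Sequences of at most polynomial growth. -/
def PolyBounded (c : ℕ → ℝ) : Prop :=
  ∃ (M : ℝ) (j : ℕ), ∀ n, |c n| ≤ M * (n : ℝ) ^ j

theorem PolyBounded.natCast_mul {c : ℕ → ℝ} (hc : PolyBounded c) :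
    PolyBounded fun n => n * c n := by
  obtain ⟨M, j, h⟩ := hc
  refine ⟨M, j + 1, fun n => ?_⟩
  rw [abs_mul, Nat.abs_cast, pow_succ, ← mul_assoc, mul_comm]
  exact mul_le_mul_of_nonneg_right (h n) n.cast_nonneg

theorem PolyBounded.const_mul {c : ℕ → ℝ} (hc : PolyBounded c) (r : ℝ) :
    PolyBounded fun n => r * c n := by
  obtain ⟨M, j, h⟩ := hc
  refine ⟨|r| * M, j, fun n => ?_⟩
  rw [abs_mul, mul_assoc]
  exact mul_le_mul_of_nonneg_left (h n) (abs_nonneg r)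

theorem PolyBounded.summable_abs_mul_exp {c : ℕ → ℝ} (hc : PolyBounded c) {k δ : ℝ}
    (hk : k ≠ 0) (hδ : 0 < δ) :
    Summable fun n : ℕ => |c n| * Real.exp (-(k ^ 2) * n ^ 2 * δ) := by
  obtain ⟨M, j, h⟩ := hc
  have hr : 0 < k ^ 2 * δ := by positivity
  refine Summable.of_nonneg_of_le (fun n => by positivity) (fun n => ?_)
    ((Real.summable_pow_mul_exp_neg_nat_mul j hr).mul_left M)
  have hn : (n : ℝ) ≤ (n : ℝ) ^ 2 := by exact_mod_cast Nat.le_self_pow two_ne_zero n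
  rw [← mul_assoc]
  refine mul_le_mul (h n) (Real.exp_le_exp.2 ?_) (Real.exp_nonneg _) ((abs_nonneg _).trans (h n))
  nlinarith [mul_le_mul_of_nonneg_left hn hr.le]

theorem abs_heatTerm_le {k δ : ℝ} (c : ℕ → ℝ) (θ : ℝ) (n : ℕ) {p : ℝ × ℝ} (hp : δ ≤ p.2) :
    |heatTerm k c θ n p| ≤ |c n| * Real.exp (-(k ^ 2) * n ^ 2 * δ) := by
  rw [heatTerm, abs_mul, abs_mul, Real.abs_exp]
  refine (mul_le_of_le_one_right (by positivity) (Real.abs_sin_le_one _)).trans ?_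
  refine mul_le_mul_of_nonneg_left (Real.exp_le_exp.2 ?_) (abs_nonneg _)
  have : 0 ≤ k ^ 2 * (n : ℝ) ^ 2 := by positivity
  nlinarith [mul_le_mul_of_nonneg_left hp this]

theorem summable_heatTerm {k : ℝ} (hk : k ≠ 0) {c : ℕ → ℝ} (hc : PolyBounded c) (θ : ℝ)
    {p : ℝ × ℝ} (hp : 0 < p.2) : Summable fun n => heatTerm k c θ n p :=
  .of_norm_bounded (hc.summable_abs_mul_exp hk hp) fun n => abs_heatTerm_le c θ n le_rfl

theorem hasFDerivAt_heatTerm (k : ℝ) (c : ℕ → ℝ) (θ : ℝ) (n : ℕ) (p : ℝ × ℝ) :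
    HasFDerivAt (heatTerm k c θ n)
      (heatTerm k (fun n => n * c n) (θ + π / 2) n p • ContinuousLinearMap.fst ℝ ℝ ℝ +
        heatTerm k (fun n => -k ^ 2 * (n * (n * c n))) θ n p •
          ContinuousLinearMap.snd ℝ ℝ ℝ) p := by
  have hx : HasFDerivAt (fun q : ℝ × ℝ => q.1) (ContinuousLinearMap.fst ℝ ℝ ℝ) p := hasFDerivAt_fst
  have ht : HasFDerivAt (fun q : ℝ × ℝ => q.2) (ContinuousLinearMap.snd ℝ ℝ ℝ) p := hasFDerivAt_snd
  have h := ((ht.const_mul (-(k ^ 2) * (n : ℝ) ^ 2)).exp.const_mul (c n)).mul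
    ((hx.const_mul (n : ℝ)).add_const θ).sin
  refine h.congr_fderiv ?_
  ext <;> simp [heatTerm, ← add_assoc, Real.sin_add_pi_div_two] <;> ring

theorem hasFDerivAt_heatSeries {k : ℝ} (hk : k ≠ 0) {c : ℕ → ℝ} (hc : PolyBounded c) (θ : ℝ)
    {p : ℝ × ℝ} (hp : 0 < p.2) :
    HasFDerivAt (heatSeries k c θ)
      (heatSeries k (fun n => n * c n) (θ + π / 2) p • ContinuousLinearMap.fst ℝ ℝ ℝ +
        heatSeries k (fun n => -k ^ 2 * (n * (n * c n))) θ p •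
          ContinuousLinearMap.snd ℝ ℝ ℝ) p := by
  have hcx := hc.natCast_mul
  have hct := hcx.natCast_mul.const_mul (-k ^ 2)
  have hδ : 0 < p.2 / 2 := half_pos hp
  have hmem : p ∈ {q : ℝ × ℝ | p.2 / 2 < q.2} := half_lt_self hp
  have hconv : Convex ℝ {q : ℝ × ℝ | p.2 / 2 < q.2} :=
    convex_halfSpace_gt (IsLinearMap.mk (fun _ _ => rfl) fun _ _ => rfl) _
  have h := hasFDerivAt_tsum_of_isPreconnected
    ((hcx.summable_abs_mul_exp hk hδ).add (hct.summable_abs_mul_exp hk hδ))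
    (isOpen_lt continuous_const continuous_snd) hconv.isPreconnected
    (fun n q _ => hasFDerivAt_heatTerm k c θ n q) (fun n q hq => ?_) hmem
    (summable_heatTerm hk hc θ hp) hmem
  · refine h.congr_fderiv ?_
    have hsx := summable_heatTerm hk hcx (θ + π / 2) hp
    have hst := summable_heatTerm hk hct θ hp
    rw [(hsx.smul_const _).tsum_add (hst.smul_const _), hsx.tsum_smul_const, hst.tsum_smul_const]
    rfl
  · have hq' : p.2 / 2 ≤ q.2 := le_of_lt hq
    refine (norm_add_le _ _).trans (add_le_add ?_ ?_)
    · rw [norm_smul]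
      exact (mul_le_of_le_one_right (norm_nonneg _) (ContinuousLinearMap.norm_fst_le ..)).trans
        (abs_heatTerm_le _ _ n hq')
    · rw [norm_smul]
      exact (mul_le_of_le_one_right (norm_nonneg _) (ContinuousLinearMap.norm_snd_le ..)).trans
        (abs_heatTerm_le _ _ n hq')

theorem contDiffOn_heatSeries {k : ℝ} (hk : k ≠ 0) (m : ℕ) {c : ℕ → ℝ} (hc : PolyBounded c)
    (θ : ℝ) : ContDiffOn ℝ m (heatSeries k c θ) {p : ℝ × ℝ | 0 < p.2} := by
  have ho : IsOpen {p : ℝ × ℝ | 0 < p.2} := isOpen_lt continuous_const continuous_snd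
  induction m generalizing c θ with
  | zero =>
    exact contDiffOn_zero.2 fun p hp =>
      (hasFDerivAt_heatSeries hk hc θ hp).continuousAt.continuousWithinAt
  | succ m ih =>
    have hcx := hc.natCast_mul
    have hct := hcx.natCast_mul.const_mul (-k ^ 2)
    push_cast
    refine (contDiffOn_succ_iff_fderiv_of_isOpen ho).2 ⟨fun p hp =>
      (hasFDerivAt_heatSeries hk hc θ hp).differentiableAt.differentiableWithinAt,
      by simp, ?_⟩
    exact (((ih hcx _).smul contDiffOn_const).add ((ih hct θ).smul contDiffOn_const)).congr
      fun p hp => (hasFDerivAt_heatSeries hk hc θ hp).fderiv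

theorem hasDerivAt_heatSeries_space {k : ℝ} (hk : k ≠ 0) {c : ℕ → ℝ} (hc : PolyBounded c)
    (θ x : ℝ) {t : ℝ} (ht : 0 < t) :
    HasDerivAt (fun y => heatSeries k c θ (y, t))
      (heatSeries k (fun n => n * c n) (θ + π / 2) (x, t)) x := by
  have h := (hasFDerivAt_heatSeries hk hc θ (p := (x, t)) ht).comp_hasDerivAt x
    ((hasDerivAt_id x).prodMk (hasDerivAt_const x t))
  exact h.congr_deriv (by simp)

theorem hasDerivAt_heatSeries_time {k : ℝ} (hk : k ≠ 0) {c : ℕ → ℝ} (hc : PolyBounded c)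
    (θ x : ℝ) {t : ℝ} (ht : 0 < t) :
    HasDerivAt (fun s => heatSeries k c θ (x, s))
      (heatSeries k (fun n => -k ^ 2 * (n * (n * c n))) θ (x, t)) t := by
  have h := (hasFDerivAt_heatSeries hk hc θ (p := (x, t)) ht).comp_hasDerivAt t
    ((hasDerivAt_const t x).prodMk (hasDerivAt_id t))
  exact h.congr_deriv (by simp)

theorem heatSeries_heat_equation {k : ℝ} (hk : k ≠ 0) {c : ℕ → ℝ} (hc : PolyBounded c)
    (θ x : ℝ) {t : ℝ} (ht : 0 < t) :
    deriv (fun s => heatSeries k c θ (x, s)) t =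
      k ^ 2 * deriv (deriv fun y => heatSeries k c θ (y, t)) x := by
  have hd : deriv (fun y => heatSeries k c θ (y, t)) =
      fun y => heatSeries k (fun n => n * c n) (θ + π / 2) (y, t) :=
    funext fun y => (hasDerivAt_heatSeries_space hk hc θ y ht).deriv
  rw [(hasDerivAt_heatSeries_time hk hc θ x ht).deriv, hd,
    (hasDerivAt_heatSeries_space hk hc.natCast_mul _ x ht).deriv, heatSeries, heatSeries,
    ← tsum_mul_left]
  refine tsum_congr fun n => ?_
  simp only [heatTerm, ← add_assoc, Real.sin_add_pi_div_two, Real.cos_add_pi_div_two]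
  ring

theorem heat_equation_series_solution
    (k : ℝ) (hk : k ≠ 0) (b : ℕ → ℝ) (M : ℝ) (hb : ∀ n, |b n| ≤ M) :
    (∀ x t : ℝ, 0 < t → Summable fun n : ℕ =>
        b n * Real.exp (-(k ^ 2) * n ^ 2 * t) * Real.sin (n * x)) ∧
    ContDiffOn ℝ 2
      (fun p : ℝ × ℝ =>
        ∑' n : ℕ, b n * Real.exp (-(k ^ 2) * n ^ 2 * p.2) * Real.sin (n * p.1))
      {p : ℝ × ℝ | 0 < p.2} ∧
    (∀ x t : ℝ, 0 < t →
        deriv (fun t' : ℝ =>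
            ∑' n : ℕ, b n * Real.exp (-(k ^ 2) * n ^ 2 * t') * Real.sin (n * x)) t =
          k ^ 2 * deriv (deriv (fun x' : ℝ =>
            ∑' n : ℕ, b n * Real.exp (-(k ^ 2) * n ^ 2 * t) * Real.sin (n * x'))) x) ∧
    (∀ t : ℝ, 0 < t →
        (∑' n : ℕ, b n * Real.exp (-(k ^ 2) * n ^ 2 * t) * Real.sin (n * (0 : ℝ))) = 0 ∧
        (∑' n : ℕ, b n * Real.exp (-(k ^ 2) * n ^ 2 * t) * Real.sin (n * π)) = 0) := by
  have hc : PolyBounded b := ⟨M, 0, by simpa using hb⟩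
  have hterm (x t : ℝ) (n : ℕ) :
      b n * Real.exp (-(k ^ 2) * n ^ 2 * t) * Real.sin (n * x) = heatTerm k b 0 n (x, t) := by
    simp [heatTerm]
  refine ⟨fun x t ht => ?_, ?_, fun x t ht => ?_, fun t _ => ⟨by simp, by simp⟩⟩
  · simpa only [hterm] using summable_heatTerm hk hc 0 (p := (x, t)) ht
  · simp only [hterm]
    exact contDiffOn_heatSeries hk 2 hc 0
  · simp only [hterm]
    exact heatSeries_heat_equation hk hc 0 x ht
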